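/- Fix a probability vector q = (q_w, q_d, q_ℓ) with q_w < q_ℓ, and let X_N be the score after N i.i.d. rounds where each round's increment is +1 with probability q_w, 0 with probability q_d, and −1 with probability q_ℓ, starting from X_0 = 0. Then for every N ≥ 1 the fixed-style gain g_N^Def := E[sign(X_N)] (with sign(0) = 0) is strictly negative, P(X_N > 0) < 1/2, and g_N^Def → −1 as N → ∞. -/

import Mathlib

noncomputable section

open Filter Topology Finset

/-- The sign of an integer score, as a real number (`sgn 0 = 0`). -/
def sgn (x : ℤ) : ℝ := if 0 < x then 1 else if x < 0 then -1 else 0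

/-- Expected sign of the score after one more game played with win/draw/loss
probabilities `w, d, l`, starting from score `x`. -/
def stepVal (w d l : ℝ) (x : ℤ) : ℝ := w * sgn (x + 1) + d * sgn x + l * sgn (x - 1)

/-- Bellman value function with `k` games remaining: `bellman p q k x = V_{N-k}^N(x)`.
With no game remaining the value is the sign of the score; otherwise Player 1 picks the
better of the offensive style `(pw, pd, pl)` and the defensive style `(qw, qd, ql)`. -/
def bellman (pw pd pl qw qd ql : ℝ) : ℕ → ℤ → ℝ
  | 0, x => sgn x
  | k + 1, x =>
      max
        (pw * bellman pw pd pl qw qd ql k (x + 1) + pd * bellman pw pd pl qw qd ql k x +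
          pl * bellman pw pd pl qw qd ql k (x - 1))
        (qw * bellman pw pd pl qw qd ql k (x + 1) + qd * bellman pw pd pl qw qd ql k x +
          ql * bellman pw pd pl qw qd ql k (x - 1))

/-- Optimal gain over `N` games: `g*_N = V_0^N(0)`. -/
def gOpt (pw pd pl qw qd ql : ℝ) (N : ℕ) : ℝ := bellman pw pd pl qw qd ql N 0

/-- The two playing styles of Player 1. -/
inductive Style
  | offense
  | defense
deriving DecidableEq

/-- Selects the probability attached to a style: `a` for offense, `b` for defense. -/
def styleP (a b : ℝ) : Style → ℝ
  | .offense => a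
  | .defense => b

/-- Probability mass function of the score process `X_n` under the policy `π`
(playing `π n x` at round `n+1` when the current score is `x`), started at `X_0 = 0`. -/
def polDist (pw pd pl qw qd ql : ℝ) (π : ℕ → ℤ → Style) : ℕ → ℤ → ℝ
  | 0, x => if x = 0 then 1 else 0
  | n + 1, x =>
      polDist pw pd pl qw qd ql π n (x - 1) * styleP pw qw (π n (x - 1)) +
      polDist pw pd pl qw qd ql π n x * styleP pd qd (π n x) +
      polDist pw pd pl qw qd ql π n (x + 1) * styleP pl ql (π n (x + 1))

/-- Gain of policy `π` over `n` games: `g_n^π = E[sign (X_n)]`. -/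
def gPol (pw pd pl qw qd ql : ℝ) (π : ℕ → ℤ → Style) (n : ℕ) : ℝ :=
  ∑' x : ℤ, polDist pw pd pl qw qd ql π n x * sgn x

/-- Probability mass function of the pair (score, switched-to-defense flag) under the
catenaccio policy: play offense until the score first reaches `+1`, then defense forever. -/
def catDist (pw pd pl qw qd ql : ℝ) : ℕ → ℤ → Bool → ℝ
  | 0, x, b => if x = 0 ∧ b = false then 1 else 0
  | n + 1, x, true =>
      catDist pw pd pl qw qd ql n (x - 1) true * qw +
      catDist pw pd pl qw qd ql n x true * qd +
      catDist pw pd pl qw qd ql n (x + 1) true * ql +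
      (if x = 1 then
        catDist pw pd pl qw qd ql n 0 false * pw +
        catDist pw pd pl qw qd ql n 1 false * pd +
        catDist pw pd pl qw qd ql n 2 false * pl
       else 0)
  | n + 1, x, false =>
      if x = 1 then 0
      else
        catDist pw pd pl qw qd ql n (x - 1) false * pw +
        catDist pw pd pl qw qd ql n x false * pd +
        catDist pw pd pl qw qd ql n (x + 1) false * pl

/-- Gain of the catenaccio policy over `N` games: `g_N^(cat) = E[sign (X_N)]`. -/
def gCat (pw pd pl qw qd ql : ℝ) (N : ℕ) : ℝ :=
  ∑' x : ℤ,
    (catDist pw pd pl qw qd ql N x false + catDist pw pd pl qw qd ql N x true) * sgn x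

/-- Gain of the catenaccio+ policy over `N` games: play catenaccio, except that if the
score after `N - 1` games is `0`, the last game is played with the better of the two
styles (offense if `pw - pl > qw - ql`, defense otherwise). -/
def gCatPlus (pw pd pl qw qd ql : ℝ) : ℕ → ℝ
  | 0 => 0
  | N + 1 =>
      ∑' x : ℤ,
        (catDist pw pd pl qw qd ql N x false *
            (if x = 0 then (if pw - pl > qw - ql then pw - pl else qw - ql)
             else stepVal pw pd pl x) +
          catDist pw pd pl qw qd ql N x true *
            (if x = 0 then (if pw - pl > qw - ql then pw - pl else qw - ql)
             else stepVal qw qd ql x))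

/-- Probability mass function of the lazy random walk with i.i.d. increments (+1 with
probability `qw`, 0 with probability `qd`, −1 with probability `ql`), started at `0`. -/
def walkDist (qw qd ql : ℝ) : ℕ → ℤ → ℝ
  | 0, x => if x = 0 then 1 else 0
  | n + 1, x =>
      walkDist qw qd ql n (x - 1) * qw + walkDist qw qd ql n x * qd +
        walkDist qw qd ql n (x + 1) * ql

/-- Fixed-style gain over `N` games for the walk with step law `(qw, qd, ql)`. -/
def gFixed (qw qd ql : ℝ) (N : ℕ) : ℝ := ∑' x : ℤ, walkDist qw qd ql N x * sgn x

/-- Probability mass function of the lazy random walk with step law `(pw, pd, pl)`,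
started at `0` and absorbed (stopped) at the level `+1`.  In particular
`stoppedDist pw pd pl n 1` is the probability that the walk reaches `+1` by time `n`. -/
def stoppedDist (pw pd pl : ℝ) : ℕ → ℤ → ℝ
  | 0, x => if x = 0 then 1 else 0
  | n + 1, x =>
      if x = 1 then
        stoppedDist pw pd pl n 1 + stoppedDist pw pd pl n 0 * pw +
          stoppedDist pw pd pl n 2 * pl
      else
        (if x - 1 = 1 then 0 else stoppedDist pw pd pl n (x - 1) * pw) +
          stoppedDist pw pd pl n x * pd +
          (if x + 1 = 1 then 0 else stoppedDist pw pd pl n (x + 1) * pl)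

lemma walkDist_nonneg {qw qd ql : ℝ} (hqw : 0 ≤ qw) (hqd : 0 ≤ qd) (hql : 0 ≤ ql)
    (N : ℕ) (x : ℤ) : 0 ≤ walkDist qw qd ql N x := by
  induction N generalizing x with
  | zero => simp only [walkDist]; split_ifs <;> norm_num
  | succ n ih =>
    simp only [walkDist]
    have h₁ := mul_nonneg (ih (x - 1)) hqw
    have h₂ := mul_nonneg (ih x) hqd
    have h₃ := mul_nonneg (ih (x + 1)) hql
    positivity

lemma walkDist_eq_zero_of_lt_abs (qw qd ql : ℝ) (N : ℕ) (x : ℤ) (hx : (N : ℤ) < |x|) :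
    walkDist qw qd ql N x = 0 := by
  induction N generalizing x with
  | zero =>
    have : x ≠ 0 := by rintro rfl; simp at hx
    simp [walkDist, this]
  | succ n ih =>
    push_cast at hx
    have h₁ : (n : ℤ) < |x - 1| := by grind
    have h₂ : (n : ℤ) < |x| := by grind
    have h₃ : (n : ℤ) < |x + 1| := by grind
    simp [walkDist, ih _ h₁, ih _ h₂, ih _ h₃]

lemma summable_walkDist_mul (qw qd ql : ℝ) (N : ℕ) (h : ℤ → ℝ) :
    Summable fun x => walkDist qw qd ql N x * h x := by
  refine summable_of_ne_finset_zero (s := Finset.Icc (-(N : ℤ)) N) fun x hx => ?_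
  rw [walkDist_eq_zero_of_lt_abs, zero_mul]
  contrapose! hx
  exact Finset.mem_Icc.2 (abs_le.1 hx)

/-- One-step recursion for expectations under the walk. -/
lemma tsum_walkDist_succ_mul (qw qd ql : ℝ) (N : ℕ) (h : ℤ → ℝ) :
    ∑' x, walkDist qw qd ql (N + 1) x * h x =
      ∑' x, walkDist qw qd ql N x * (qw * h (x + 1) + qd * h x + ql * h (x - 1)) := by
  have s₁ := summable_walkDist_mul qw qd ql N fun x => qw * h (x + 1)
  have s₂ := summable_walkDist_mul qw qd ql N fun x => qd * h x
  have s₃ := summable_walkDist_mul qw qd ql N fun x => ql * h (x - 1)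
  have t₁ := (Equiv.subRight (1 : ℤ)).hasSum_iff.2 s₁.hasSum
  have t₃ := (Equiv.addRight (1 : ℤ)).hasSum_iff.2 s₃.hasSum
  calc _ = _ := tsum_congr fun x => ?_
    _ = _ := ((t₁.add s₂.hasSum).add t₃).tsum_eq
    _ = _ := ?_
  · simp [walkDist]
    ring
  · rw [← s₁.tsum_add s₂, ← (s₁.add s₂).tsum_add s₃]
    simp only [mul_add]

/-- Exponential moments of the walk. -/
lemma tsum_walkDist_mul_zpow (qw qd ql : ℝ) {t : ℝ} (ht : t ≠ 0) (N : ℕ) :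
    ∑' x, walkDist qw qd ql N x * t ^ x = (qw * t + qd + ql * t⁻¹) ^ N := by
  induction N with
  | zero => simp [walkDist]
  | succ n ih =>
    rw [tsum_walkDist_succ_mul, pow_succ, ← ih, ← tsum_mul_right]
    refine tsum_congr fun x => ?_
    rw [zpow_add₀ ht, zpow_sub₀ ht]
    simp only [zpow_one]
    field_simp

lemma tsum_walkDist {qw qd ql : ℝ} (hq : qw + qd + ql = 1) (N : ℕ) :
    ∑' x, walkDist qw qd ql N x = 1 := by
  simpa [hq] using tsum_walkDist_mul_zpow qw qd ql one_ne_zero N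

/-- Reflection identity: opposite positions are weighted by powers of `ql` and `qw`. -/
lemma pow_mul_walkDist_natCast (qw qd ql : ℝ) (N k : ℕ) :
    ql ^ k * walkDist qw qd ql N k = qw ^ k * walkDist qw qd ql N (-k) := by
  induction N generalizing k with
  | zero =>
    rcases k with _ | k
    · simp
    · have h₁ : ((k + 1 : ℕ) : ℤ) ≠ 0 := by omega
      have h₂ : -((k + 1 : ℕ) : ℤ) ≠ 0 := by omega
      simp only [walkDist, h₁, h₂, if_false, mul_zero]
  | succ n ih =>
    rcases k with _ | k
    · simp
    have h₀ := ih k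
    have h₁ := ih (k + 1)
    have h₂ := ih (k + 2)
    simp only [walkDist]
    push_cast at *
    rw [show (k : ℤ) + 1 - 1 = k by ring, show (k : ℤ) + 1 + 1 = k + 2 by ring,
      show -((k : ℤ) + 1) - 1 = -(k + 2) by ring, show -((k : ℤ) + 1) + 1 = -k by ring]
    linear_combination qw * ql * h₀ + qd * h₁ + h₂

lemma walkDist_natCast_le_neg {qw qd ql : ℝ} (hqw : 0 ≤ qw) (hqd : 0 ≤ qd)
    (hlose : qw < ql) (N k : ℕ) :
    walkDist qw qd ql N k ≤ walkDist qw qd ql N (-k) := by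
  have hl : 0 < ql := hqw.trans_lt hlose
  refine le_of_mul_le_mul_left ?_ (pow_pos hl k)
  rw [pow_mul_walkDist_natCast]
  gcongr
  exact walkDist_nonneg hqw hqd hl.le N _

lemma walkDist_natCast_self (qw qd ql : ℝ) (N : ℕ) : walkDist qw qd ql N N = qw ^ N := by
  induction N with
  | zero => simp [walkDist]
  | succ n ih =>
    simp only [walkDist]
    rw [walkDist_eq_zero_of_lt_abs qw qd ql n ((n + 1 : ℕ) : ℤ) (by grind),
      walkDist_eq_zero_of_lt_abs qw qd ql n (((n + 1 : ℕ) : ℤ) + 1) (by grind)]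
    push_cast
    rw [add_sub_cancel_right, ih]
    ring

lemma walkDist_neg_natCast_self (qw qd ql : ℝ) (N : ℕ) :
    walkDist qw qd ql N (-N) = ql ^ N := by
  induction N with
  | zero => simp [walkDist]
  | succ n ih =>
    simp only [walkDist]
    rw [walkDist_eq_zero_of_lt_abs qw qd ql n (-((n + 1 : ℕ) : ℤ)) (by grind),
      walkDist_eq_zero_of_lt_abs qw qd ql n (-((n + 1 : ℕ) : ℤ) - 1) (by grind)]
    push_cast
    rw [show -((n : ℤ) + 1) + 1 = -n by ring, ih]
    ring

lemma sgn_neg (x : ℤ) : sgn (-x) = -sgn x := by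
  unfold sgn
  split_ifs <;> first | omega | norm_num

lemma gFixed_neg {qw qd ql : ℝ} (hqw : 0 ≤ qw) (hqd : 0 ≤ qd) (hlose : qw < ql)
    {N : ℕ} (hN : 1 ≤ N) : gFixed qw qd ql N < 0 := by
  have s := summable_walkDist_mul qw qd ql N sgn
  have s' := (Equiv.neg ℤ).hasSum_iff.2 s.hasSum
  have hsum := s.hasSum.add s'
  have hpos : ∀ x : ℤ, 0 < x → walkDist qw qd ql N x ≤ walkDist qw qd ql N (-x) := by
    intro x hx
    lift x to ℕ using hx.le
    exact walkDist_natCast_le_neg hqw hqd hlose N x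
  have hlt := hasSum_lt (f := _) (g := fun _ : ℤ => (0 : ℝ)) (i := (N : ℤ)) ?_ ?_ hsum
    hasSum_zero
  · unfold gFixed
    linarith
  · intro x
    simp only [Function.comp, Equiv.neg_apply, sgn_neg]
    rcases lt_trichotomy x 0 with hx | rfl | hx
    · have := hpos (-x) (by omega)
      rw [neg_neg] at this
      simp [sgn, hx, hx.not_gt]
      linarith
    · simp [sgn]
    · have := hpos x hx
      simp [sgn, hx]
      linarith
  · have hN' : (0 : ℤ) < N := by omega
    have := pow_lt_pow_left₀ hlose hqw (by omega : N ≠ 0)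
    simp only [Function.comp, Equiv.neg_apply, sgn_neg, walkDist_natCast_self,
      walkDist_neg_natCast_self]
    simp only [sgn, hN', if_true]
    linarith

lemma tsum_pos_walkDist_le {qw qd ql : ℝ} (hqw : 0 ≤ qw) (hqd : 0 ≤ qd) (hql : 0 ≤ ql)
    (hq : qw + qd + ql = 1) (N : ℕ) :
    (∑' x : ℤ, if 0 < x then walkDist qw qd ql N x else 0) ≤ (1 + gFixed qw qd ql N) / 2 := by
  have s₁ := summable_walkDist_mul qw qd ql N fun x => if 0 < x then 1 else 0
  have s₂ := summable_walkDist_mul qw qd ql N fun _ => 1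
  have s₃ := summable_walkDist_mul qw qd ql N sgn
  simp only [mul_ite, mul_one, mul_zero] at s₁ s₂
  rw [gFixed, ← tsum_walkDist hq N, ← s₂.tsum_add s₃, ← tsum_div_const]
  refine s₁.tsum_le_tsum (fun x => ?_) ((s₂.add s₃).div_const 2)
  have := walkDist_nonneg hqw hqd hql N x
  unfold sgn
  split_ifs <;> linarith

lemma one_add_gFixed_eq {qw qd ql : ℝ} (hq : qw + qd + ql = 1) (N : ℕ) :
    1 + gFixed qw qd ql N = ∑' x, walkDist qw qd ql N x * (1 + sgn x) := by
  have s₂ := summable_walkDist_mul qw qd ql N fun _ => 1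
  have s₃ := summable_walkDist_mul qw qd ql N sgn
  simp only [mul_one] at s₂
  simp only [mul_add, mul_one]
  rw [s₂.tsum_add s₃, tsum_walkDist hq, gFixed]

/-- Chernoff bound for the gain. -/
lemma one_add_gFixed_le {qw qd ql : ℝ} (hqw : 0 ≤ qw) (hqd : 0 ≤ qd) (hql : 0 ≤ ql)
    (hq : qw + qd + ql = 1) {t : ℝ} (ht : 1 ≤ t) (N : ℕ) :
    1 + gFixed qw qd ql N ≤ 2 * (qw * t + qd + ql * t⁻¹) ^ N := by
  have ht₀ : 0 < t := by linarith
  rw [one_add_gFixed_eq hq, ← tsum_walkDist_mul_zpow _ _ _ ht₀.ne', ← tsum_mul_left]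
  refine (summable_walkDist_mul _ _ _ _ _).tsum_le_tsum (fun x => ?_)
    ((summable_walkDist_mul _ _ _ _ _).mul_left 2)
  rw [mul_left_comm]
  refine mul_le_mul_of_nonneg_left ?_ (walkDist_nonneg hqw hqd hql N x)
  rcases lt_or_ge x 0 with hx | hx
  · have := zpow_pos ht₀ x
    simp only [sgn, hx, hx.not_gt, if_true, if_false]
    linarith
  · have := one_le_zpow₀ ht hx
    unfold sgn
    split_ifs <;> linarith

lemma tendsto_gFixed {qw qd ql : ℝ} (hqw : 0 ≤ qw) (hqd : 0 ≤ qd) (hql : 0 ≤ ql)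
    (hq : qw + qd + ql = 1) (hlose : qw < ql) :
    Tendsto (fun N : ℕ => gFixed qw qd ql N) atTop (𝓝 (-1)) := by
  set t : ℝ := 1 + (ql - qw) with ht
  have ht₁ : 1 ≤ t := by linarith
  have ht₀ : 0 < t := by linarith
  have hφ₀ : 0 ≤ qw * t + qd + ql * t⁻¹ := by positivity
  have hφ₁ : qw * t + qd + ql * t⁻¹ < 1 := by
    rw [← sub_neg, show qw * t + qd + ql * t⁻¹ - 1 = (qw * t ^ 2 + qd * t + ql - t) / t by
      field_simp]
    refine div_neg_of_neg_of_pos ?_ ht₀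
    have hd : qd = 1 - qw - ql := by linarith
    have : qw * t ^ 2 + qd * t + ql - t = -((ql - qw) ^ 2 * (1 - qw)) := by
      rw [ht, hd]; ring
    rw [this, neg_lt_zero]
    exact mul_pos (pow_pos (by linarith) 2) (by linarith)
  have hlim := ((tendsto_pow_atTop_nhds_zero_of_lt_one hφ₀ hφ₁).const_mul 2).sub_const 1
  rw [mul_zero, zero_sub] at hlim
  refine tendsto_of_tendsto_of_tendsto_of_le_of_le tendsto_const_nhds hlim (fun N => ?_)
    fun N => ?_
  · have : 0 ≤ 1 + gFixed qw qd ql N := by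
      rw [one_add_gFixed_eq hq]
      refine tsum_nonneg fun x => mul_nonneg (walkDist_nonneg hqw hqd hql N x) ?_
      unfold sgn
      split_ifs <;> norm_num
    show -1 ≤ gFixed qw qd ql N
    linarith
  · have := one_add_gFixed_le hqw hqd hql hq ht₁ N
    show gFixed qw qd ql N ≤ 2 * (qw * t + qd + ql * t⁻¹) ^ N - 1
    linarith

/-- For the lazy random walk with step law `(qw, qd, ql)` and
`qw < ql`, the fixed-style gain `g_N^Def = E[sign (X_N)]` is strictly negative for every
`N ≥ 1`, the probability of a strictly positive position is `< 1/2`, and the gain tends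
to `−1` as `N → ∞`. -/
theorem fixed_style_gain_neg_of_losing
    (qw qd ql : ℝ)
    (hqw : 0 ≤ qw) (hqd : 0 ≤ qd) (hql : 0 ≤ ql) (hq : qw + qd + ql = 1)
    (hlose : qw < ql) :
    (∀ N : ℕ, 1 ≤ N →
        gFixed qw qd ql N < 0 ∧
          (∑' x : ℤ, if 0 < x then walkDist qw qd ql N x else 0) < 1 / 2) ∧
      Tendsto (fun N : ℕ => gFixed qw qd ql N) atTop (𝓝 (-1)) := by
  refine ⟨fun N hN => ?_, tendsto_gFixed hqw hqd hql hq hlose⟩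
  have hg := gFixed_neg hqw hqd hlose hN
  have hp := tsum_pos_walkDist_le hqw hqd hql hq N
  exact ⟨hg, by linarith⟩
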